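/- arXiv:math/0601008 — 2 statements merged into one kernel-verified Lean document; each statement's English description precedes it below -/
import Mathlib

section
/- Let f : A → B be a homomorphism of abelian groups such that for every integer m ≥ 2 the induced map A ⊗ ℤ/m → B ⊗ ℤ/m is injective and the induced map A[m] → B[m] on m-torsion subgroups is surjective. Then the kernel of f is a divisible abelian group. -/
open scoped TensorProduct in
/-- An element `x` with `x ⊗ 1 = 0` in `A ⊗ ℤ/m` is a multiple of `m`. -/
theorem exists_nsmul_eq_of_tmul_one_eq_zero {A : Type*} [AddCommGroup A] (m : ℕ) (x : A)
    (hx : x ⊗ₜ[ℤ] (1 : ZMod m) = 0) : ∃ a : A, m • a = x := by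
  let S : AddSubgroup A := (nsmulAddMonoidHom m : A →+ A).range
  let _ : Module (ZMod m) (A ⧸ S) := QuotientAddGroup.zmodModule fun a ↦ ⟨a, rfl⟩
  let g : A ⊗[ℤ] ZMod m →+ A ⧸ S :=
    TensorProduct.liftAddHom ((smulAddHom (ZMod m) (A ⧸ S)).flip.comp (QuotientAddGroup.mk' S))
      fun r a n ↦ by simp [mul_smul, Int.cast_smul_eq_zsmul]
  have hg : g (x ⊗ₜ[ℤ] (1 : ZMod m)) = (x : A ⧸ S) := by
    simp [g]
  rw [hx, map_zero] at hg
  exact (QuotientAddGroup.eq_zero_iff x).mp hg.symm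

/-- If `f : A → B` is a homomorphism of abelian groups such that for every integer `m ≥ 2`
the induced map `A ⊗ ℤ/m → B ⊗ ℤ/m` is injective and the induced map `A[m] → B[m]` on
`m`-torsion subgroups is surjective, then the kernel of `f` is a divisible abelian group. -/
theorem stmt_0 {A B : Type*} [AddCommGroup A] [AddCommGroup B] (f : A →+ B)
    (htensor : ∀ m : ℕ, 2 ≤ m →
      Function.Injective (LinearMap.rTensor (ZMod m) f.toIntLinearMap))
    (htors : ∀ m : ℕ, 2 ≤ m → ∀ b : B, m • b = 0 → ∃ a : A, m • a = 0 ∧ f a = b) :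
    ∀ m : ℕ, 1 ≤ m → ∀ x ∈ f.ker, ∃ y ∈ f.ker, m • y = x := by
  intro m hm x hx
  obtain rfl | hm := hm.eq_or_lt
  · exact ⟨x, hx, one_nsmul x⟩
  have hfx : f x = 0 := hx
  obtain ⟨a, rfl⟩ := exists_nsmul_eq_of_tmul_one_eq_zero m x <| htensor m hm <| by
    simp [LinearMap.rTensor_tmul, hfx]
  obtain ⟨t, ht, hta⟩ := htors m hm (f a) (by rwa [← map_nsmul])
  exact ⟨a - t, by simp [AddMonoidHom.mem_ker, hta], by rw [nsmul_sub, ht, sub_zero]⟩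
end

section
/- Let f : A → B be a homomorphism of abelian groups such that for every integer m ≥ 2 the induced map A ⊗ ℤ/m → B ⊗ ℤ/m is injective and the induced map A[m] → B[m] on m-torsion subgroups is surjective. If the induced map A ⊗ ℚ → B ⊗ ℚ of rational vector spaces is surjective, then f is surjective. -/
open scoped TensorProduct

/-- If `a ⊗ 1` vanishes in `A ⊗ ℤ/m`, then `a` is divisible by `m`. -/
theorem exists_nsmul_eq_of_tmul_zmod_eq_zero {A : Type*} [AddCommGroup A] (m : ℕ) (a : A)
    (h : a ⊗ₜ[ℤ] (1 : ZMod m) = 0) : ∃ a' : A, m • a' = a := by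
  let N : AddSubgroup A := (nsmulAddMonoidHom m : A →+ A).range
  let _ : Module (ZMod m) (A ⧸ N) := AddCommGroup.zmodModule fun x => by
    induction x using QuotientAddGroup.induction_on with
    | H x => exact (QuotientAddGroup.eq_zero_iff (m • x)).2 ⟨x, rfl⟩
  let φ : A →ₗ[ℤ] ZMod m →ₗ[ℤ] A ⧸ N :=
    LinearMap.mk₂ ℤ (fun a k => k • (a : A ⧸ N))
      (fun a a' k => smul_add k (a : A ⧸ N) (a' : A ⧸ N)) (fun c x k => smul_comm k c (x : A ⧸ N))
      (fun _ _ _ => add_smul _ _ _) (fun _ _ _ => smul_assoc _ _ _)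
  have hφ : φ a 1 = 0 := by
    rw [← TensorProduct.lift.tmul, h, map_zero]
  have hmk : (1 : ZMod m) • (a : A ⧸ N) = 0 := hφ
  rw [one_smul] at hmk
  exact (QuotientAddGroup.eq_zero_iff a).1 hmk

/-- If `f ⊗ ℚ` is surjective, then every element of `B` has a positive multiple in the image
of `f`. -/
theorem exists_nsmul_eq_map_of_rTensor_rat_surjective {A B : Type*} [AddCommGroup A]
    [AddCommGroup B] (f : A →+ B)
    (hQ : Function.Surjective (LinearMap.rTensor ℚ f.toIntLinearMap)) (b : B) :
    ∃ n : ℕ, 0 < n ∧ ∃ a : A, n • b = f a := by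
  let S := nonZeroDivisors ℤ
  obtain ⟨x, hx⟩ := hQ (b ⊗ₜ 1)
  obtain ⟨⟨a, s⟩, hs⟩ := IsLocalizedModule.surj S (TensorProduct.mk ℤ ℚ A 1)
    (TensorProduct.comm ℤ A ℚ x)
  have hs' : (s : ℤ) • x = a ⊗ₜ[ℤ] (1 : ℚ) := by
    apply (TensorProduct.comm ℤ A ℚ).injective
    rw [map_smul]
    exact hs
  have key : TensorProduct.mk ℤ ℚ B 1 ((s : ℤ) • b) = TensorProduct.mk ℤ ℚ B 1 (f a) := by
    have h : (s : ℤ) • (b ⊗ₜ[ℤ] (1 : ℚ)) = f a ⊗ₜ[ℤ] (1 : ℚ) := by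
      rw [← hx, ← map_zsmul, hs']
      rfl
    have h' := congrArg (TensorProduct.comm ℤ B ℚ) h
    rw [map_zsmul] at h' ⊢
    exact h'
  obtain ⟨c, hc⟩ := (IsLocalizedModule.eq_iff_exists S (TensorProduct.mk ℤ ℚ B 1)).1 key
  have hc' : ((c : ℤ) * s) • b = f ((c : ℤ) • a) := by
    rw [mul_smul, map_zsmul]
    exact hc
  have hne : (c : ℤ) * s ≠ 0 := nonZeroDivisors.ne_zero (c * s).2
  refine ⟨((c : ℤ) * s).natAbs, Int.natAbs_pos.2 hne, ?_⟩
  rw [← natCast_zsmul]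
  rcases Int.natAbs_eq ((c : ℤ) * s) with h | h
  · exact ⟨_, by rw [← h, hc']⟩
  · exact ⟨-((c : ℤ) • a), by rw [map_neg, ← hc', ← neg_smul, ← neg_eq_iff_eq_neg.2 h]⟩

/-- If `f : A → B` is a homomorphism of abelian groups such that for every integer `m ≥ 2`
the induced map `A ⊗ ℤ/m → B ⊗ ℤ/m` is injective and the induced map `A[m] → B[m]` on
`m`-torsion subgroups is surjective, and if the induced map `A ⊗ ℚ → B ⊗ ℚ` is
surjective, then `f` is surjective. -/
theorem stmt_6 {A B : Type*} [AddCommGroup A] [AddCommGroup B] (f : A →+ B)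
    (htensor : ∀ m : ℕ, 2 ≤ m →
      Function.Injective (LinearMap.rTensor (ZMod m) f.toIntLinearMap))
    (htors : ∀ m : ℕ, 2 ≤ m → ∀ b : B, m • b = 0 → ∃ a : A, m • a = 0 ∧ f a = b)
    (hQ : Function.Surjective (LinearMap.rTensor ℚ f.toIntLinearMap)) :
    Function.Surjective f := by
  intro b
  obtain ⟨n, hn, a, ha⟩ := exists_nsmul_eq_map_of_rTensor_rat_surjective f hQ b
  have hm : 2 ≤ 2 * n := by omega
  have hfa : f (2 • a) = (2 * n) • b := by rw [map_nsmul, ← ha, mul_smul]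
  have hzero : (2 • a) ⊗ₜ[ℤ] (1 : ZMod (2 * n)) = 0 := by
    apply htensor _ hm
    rw [LinearMap.rTensor_tmul, map_zero, AddMonoidHom.coe_toIntLinearMap, hfa,
      ← natCast_zsmul, TensorProduct.smul_tmul, natCast_zsmul, nsmul_one,
      ZMod.natCast_self, TensorProduct.tmul_zero]
  obtain ⟨a', ha'⟩ := exists_nsmul_eq_of_tmul_zmod_eq_zero _ _ hzero
  obtain ⟨t, -, ht⟩ := htors _ hm (b - f a') (by
    rw [smul_sub, ← map_nsmul, ha', hfa, sub_self])
  exact ⟨t + a', by rw [map_add, ht, sub_add_cancel]⟩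
end
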